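/- Let V be a real vector space with a symmetric bilinear form ⟨·,·⟩, let k ≥ 1, and let ν, α_1, …, α_k ∈ V satisfy ⟨ν,ν⟩ = −2, ⟨α_i,α_i⟩ = −2 for all i, ⟨ν,α_1⟩ = 2, ⟨ν,α_j⟩ = 0 for 2 ≤ j ≤ k, ⟨α_i,α_{i+1}⟩ = 1 for 1 ≤ i ≤ k−1, and ⟨α_i,α_j⟩ = 0 whenever |i−j| ≥ 2. Define s_1 = ν and s_{i+1} = s_i + ⟨α_i,s_i⟩α_i for 1 ≤ i ≤ k. Then ⟨s_i,s_i⟩ = −2 for all 1 ≤ i ≤ k+1, and ⟨s_i,s_j⟩ = 2 for all 1 ≤ i < j ≤ k+1. (In other words, the vectors s_1,…,s_{k+1} represent a cluster of k+1 mutually tangent spheres; this is the algebraic core of Theorem 3.1: a Coxeter graph containing a T_k subgraph with a node ν attached to one end by a bold edge produces a cluster of k+1 mutually tangent spheres.) -/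

import Mathlib

/-- With `ν, α₁, …, α_k` the nodes of a `T_k` Coxeter graph (norm `−2`) with
`ν` attached to the end by a bold edge, and `s₁ = ν`, `s_{i+1} = s_i + ⟨α_i, s_i⟩ • α_i`,
the vectors `s₁, …, s_{k+1}` form a cluster of `k+1` mutually tangent spheres:
`⟨s_i, s_i⟩ = −2` for `1 ≤ i ≤ k+1` and `⟨s_i, s_j⟩ = 2` for `1 ≤ i < j ≤ k+1`. -/
theorem statement1 (V : Type*) [AddCommGroup V] [Module ℝ V]
    (B : LinearMap.BilinForm ℝ V) (hsymm : ∀ x y : V, B x y = B y x)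
    (k : ℕ) (hk : 1 ≤ k) (ν : V) (α : ℕ → V) (s : ℕ → V)
    (hνν : B ν ν = -2)
    (hαα : ∀ i, 1 ≤ i → i ≤ k → B (α i) (α i) = -2)
    (hνα1 : B ν (α 1) = 2)
    (hνα : ∀ j, 2 ≤ j → j ≤ k → B ν (α j) = 0)
    (hadj : ∀ i, 1 ≤ i → i + 1 ≤ k → B (α i) (α (i + 1)) = 1)
    (hfar : ∀ i j, 1 ≤ i → i ≤ k → 1 ≤ j → j ≤ k → (i + 2 ≤ j ∨ j + 2 ≤ i) →
      B (α i) (α j) = 0)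
    (hs1 : s 1 = ν)
    (hrec : ∀ i, 1 ≤ i → i ≤ k → s (i + 1) = s i + (B (α i) (s i)) • α i) :
    (∀ i, 1 ≤ i → i ≤ k + 1 → B (s i) (s i) = -2) ∧
    (∀ i j, 1 ≤ i → i < j → j ≤ k + 1 → B (s i) (s j) = 2) := by
  have hsα : ∀ i, 1 ≤ i → i ≤ k →
      B (s i) (α i) = 2 ∧ ∀ j, i < j → j ≤ k → B (s i) (α j) = 0 := by
    intro i hi
    induction i, hi using Nat.le_induction with
    | base =>
      intro _
      rw [hs1]
      exact ⟨hνα1, fun j hj hjk => hνα j hj hjk⟩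
    | succ i hi ih =>
      intro hik
      obtain ⟨h2, h0⟩ := ih (by omega)
      rw [hrec i hi (by omega), hsymm (α i), h2]
      refine ⟨?_, fun j hj hjk => ?_⟩
      · simp [h0 (i + 1) (by omega) hik, hadj i hi hik]
      · simp [h0 j (by omega) hjk,
          hfar i j hi (by omega) (by omega) hjk (Or.inl (by omega))]
  have hstep : ∀ i, 1 ≤ i → i ≤ k → s (i + 1) = s i + (2 : ℝ) • α i := by
    intro i hi hik
    rw [hrec i hi hik, hsymm (α i), (hsα i hi hik).1]
  have hnorm : ∀ i, 1 ≤ i → i ≤ k + 1 → B (s i) (s i) = -2 := by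
    intro i hi
    induction i, hi using Nat.le_induction with
    | base => intro _; rw [hs1, hνν]
    | succ i hi ih =>
      intro hik
      have h2 := (hsα i hi (by omega)).1
      rw [hstep i hi (by omega)]
      simp only [map_add, map_smul, LinearMap.add_apply, LinearMap.smul_apply, smul_eq_mul,
        hsymm (α i) (s i), h2, hαα i hi (by omega), ih (by omega)]
      norm_num
  refine ⟨hnorm, fun i j hi hij => ?_⟩
  induction j, Nat.succ_le_of_lt hij using Nat.le_induction with
  | base =>
    intro hik
    rw [Nat.succ_eq_add_one, hstep i hi (by omega), map_add, map_smul, smul_eq_mul,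
      hnorm i hi (by omega), (hsα i hi (by omega)).1]
    norm_num
  | succ j hj ih =>
    intro hjk
    rw [hstep j (by omega) (by omega), map_add, map_smul, smul_eq_mul,
      (hsα i hi (by omega)).2 j (by omega) (by omega), ih (by omega) (by omega)]
    norm_num
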